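/- The 6th Fermat (CEVA) arrangement, consisting of the 18 lines in ℙ²(ℂ) defined by the linear factors of Q₆(x,y,z) = (x⁶ − y⁶)(y⁶ − z⁶)(z⁶ − x⁶), has exactly 36 triple intersection points and exactly 3 points of multiplicity 6 (the coordinate points), and no other singular points: every point of ℙ²(ℂ) lying on at least 2 of the 18 lines lies on exactly 3 or exactly 6 of them. -/

import Mathlib

open MvPolynomial

noncomputable section

/-- The complex projective plane. -/
abbrev P2 : Type := Projectivization ℂ (Fin 3 → ℂ)

/-- `ζ = e^{2πi/6}`, a primitive 6th root of unity. -/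
def ζ : ℂ := Complex.exp (2 * Real.pi * Complex.I / 6)

/-- The 18 linear forms of the 6th Fermat (CEVA) arrangement: the linear factors
`x − εy`, `y − εz`, `z − εx` (for `ε` a 6th root of unity) of
`Q₆ = (x⁶ − y⁶)(y⁶ − z⁶)(z⁶ − x⁶)`. -/
def fermatLine (i : Fin 3) (k : Fin 6) : MvPolynomial (Fin 3) ℂ :=
  X i - C (ζ ^ (k : ℕ)) * X (i + 1)

/-- The number of the 18 Fermat lines passing through a point `P`. -/
def fermatCount (P : P2) : ℕ :=
  Nat.card {p : Fin 3 × Fin 6 // MvPolynomial.eval P.rep (fermatLine p.1 p.2) = 0}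

/-- The `i`-th coordinate point of `ℙ²(ℂ)`. -/
def coordPt (i : Fin 3) : P2 :=
  Projectivization.mk ℂ (Pi.single i 1) (by
    intro h
    simpa using congrFun h i)

theorem isPrimitiveRoot_zeta : IsPrimitiveRoot ζ 6 := by
  simpa [ζ] using Complex.isPrimitiveRoot_exp 6 (by norm_num)

theorem zeta_pow_six (k : ℕ) : (ζ ^ k) ^ 6 = 1 := by
  rw [← pow_mul, mul_comm, pow_mul, isPrimitiveRoot_zeta.pow_eq_one, one_pow]

theorem zeta_pow_ne_zero (k : ℕ) : ζ ^ k ≠ 0 :=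
  pow_ne_zero _ (isPrimitiveRoot_zeta.ne_zero (by norm_num))

theorem zeta_pow_injective : Function.Injective fun k : Fin 6 => ζ ^ (k : ℕ) :=
  fun j k h => Fin.ext (isPrimitiveRoot_zeta.pow_inj j.2 k.2 h)

theorem exists_eq_zeta_pow_mul {a b : ℂ} (hb : b ≠ 0) (h : a ^ 6 = b ^ 6) :
    ∃ k : Fin 6, a = ζ ^ (k : ℕ) * b := by
  obtain ⟨k, hk, h'⟩ := isPrimitiveRoot_zeta.eq_pow_of_pow_eq_one
    (ξ := a / b) (by rw [div_pow, h, div_self (pow_ne_zero _ hb)])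
  exact ⟨⟨k, hk⟩, by simp [h', hb]⟩

/-- The number of sixth roots of unity `ε` with `a = ε b`. -/
def pencilCount (a b : ℂ) : ℕ :=
  Nat.card {k : Fin 6 // a - ζ ^ (k : ℕ) * b = 0}

theorem pencilCount_smul {c : ℂ} (hc : c ≠ 0) (a b : ℂ) :
    pencilCount (c * a) (c * b) = pencilCount a b := by
  refine Nat.card_congr (Equiv.subtypeEquivRight fun k => ?_)
  rw [mul_left_comm, ← mul_sub, mul_eq_zero, or_iff_right hc]

theorem pencilCount_zero_zero : pencilCount 0 0 = 6 := by
  simp [pencilCount]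

theorem pencilCount_of_pow_eq {a b : ℂ} (hb : b ≠ 0) (h : a ^ 6 = b ^ 6) :
    pencilCount a b = 1 := by
  obtain ⟨k, rfl⟩ := exists_eq_zeta_pow_mul hb h
  rw [pencilCount, Nat.card_eq_one_iff_exists]
  refine ⟨⟨k, sub_self _⟩, fun ⟨j, hj⟩ => Subtype.ext (zeta_pow_injective ?_)⟩
  exact (mul_right_cancel₀ hb (sub_eq_zero.mp hj)).symm

theorem pencilCount_of_pow_ne {a b : ℂ} (h : a ^ 6 ≠ b ^ 6) : pencilCount a b = 0 := by
  rw [pencilCount, Nat.card_eq_zero]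
  refine Or.inl ⟨fun ⟨k, hk⟩ => h ?_⟩
  rw [sub_eq_zero.mp hk, mul_pow, zeta_pow_six, one_mul]

theorem fermatCount_mk (v : Fin 3 → ℂ) (hv : v ≠ 0) :
    fermatCount (Projectivization.mk ℂ v hv) =
      pencilCount (v 0) (v 1) + pencilCount (v 1) (v 2) + pencilCount (v 2) (v 0) := by
  obtain ⟨a, ha⟩ := Projectivization.exists_smul_eq_mk_rep ℂ v hv
  have hcard : fermatCount (Projectivization.mk ℂ v hv) =
      ∑ i : Fin 3, pencilCount (a * v i) (a * v (i + 1)) := by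
    simp only [fermatCount, pencilCount]
    rw [← Nat.card_sigma]
    refine Nat.card_congr (Equiv.trans (Equiv.subtypeEquivRight fun p => ?_)
      (Equiv.subtypeProdEquivSigmaSubtype
        fun (i : Fin 3) (k : Fin 6) => a * v i - ζ ^ (k : ℕ) * (a * v (i + 1)) = 0))
    rw [← ha]
    simp [fermatLine, Units.smul_def]
  rw [hcard, Fin.sum_univ_three]
  simp only [pencilCount_smul a.ne_zero]
  rfl

theorem fermatCount_mk_trichotomy (v : Fin 3 → ℂ) (hv : v ≠ 0) :
    (fermatCount (Projectivization.mk ℂ v hv) = 6 ∧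
      ∃ i, ∀ j, j ≠ i → v j = 0) ∨
    (fermatCount (Projectivization.mk ℂ v hv) = 3 ∧
      v 2 ≠ 0 ∧ v 0 ^ 6 = v 2 ^ 6 ∧ v 1 ^ 6 = v 2 ^ 6) ∨
    fermatCount (Projectivization.mk ℂ v hv) ≤ 1 := by
  rw [fermatCount_mk]
  have hv' : ¬ (v 0 = 0 ∧ v 1 = 0 ∧ v 2 = 0) := fun ⟨h0, h1, h2⟩ =>
    hv (by ext i; fin_cases i <;> assumption)
  have hle (a b : ℂ) (h : a ≠ 0 ∨ b ≠ 0) :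
      (pencilCount a b = 1 ∧ a ≠ 0 ∧ b ≠ 0 ∧ a ^ 6 = b ^ 6) ∨
        (pencilCount a b = 0 ∧ a ^ 6 ≠ b ^ 6) := by
    by_cases hab : a ^ 6 = b ^ 6
    · have hab0 : a = 0 ↔ b = 0 := by
        rw [← pow_eq_zero_iff (n := 6) (by norm_num), hab, pow_eq_zero_iff (by norm_num)]
      have ha : a ≠ 0 := by tauto
      have hb : b ≠ 0 := by tauto
      exact Or.inl ⟨pencilCount_of_pow_eq hb hab, ha, hb, hab⟩
    · exact Or.inr ⟨pencilCount_of_pow_ne hab, hab⟩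
  have h01 := hle (v 0) (v 1)
  have h12 := hle (v 1) (v 2)
  have h20 := hle (v 2) (v 0)
  have hz := pencilCount_zero_zero
  simp only [Fin.exists_fin_succ, Fin.forall_fin_succ]
  by_cases h0 : v 0 = 0 <;> by_cases h1 : v 1 = 0 <;> by_cases h2 : v 2 = 0 <;>
    simp_all <;> grind

theorem coordPt_injective : Function.Injective coordPt := by
  intro i j h
  obtain ⟨a, ha⟩ := (Projectivization.mk_eq_mk_iff' ..).mp h
  by_contra hij
  simpa [Pi.single_apply, hij] using congrFun ha i

theorem mk_eq_coordPt {v : Fin 3 → ℂ} (hv : v ≠ 0) {i : Fin 3} (h : ∀ j, j ≠ i → v j = 0) :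
    Projectivization.mk ℂ v hv = coordPt i := by
  refine (Projectivization.mk_eq_mk_iff' ..).mpr ⟨v i, ?_⟩
  ext j
  by_cases hj : j = i
  · subst hj; simp
  · simp [hj, h j hj]

theorem fermatCount_coordPt (i : Fin 3) : fermatCount (coordPt i) = 6 := by
  rw [coordPt, fermatCount_mk]
  have h01 : pencilCount 0 1 = 0 := pencilCount_of_pow_ne (by norm_num)
  have h10 : pencilCount 1 0 = 0 := pencilCount_of_pow_ne (by norm_num)
  fin_cases i <;> simp [h01, h10, pencilCount_zero_zero]

theorem setOf_fermatCount_eq_six :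
    {P : P2 | fermatCount P = 6} = Set.range coordPt := by
  ext P
  constructor
  · induction P using Projectivization.ind with
    | h v hv =>
      intro (h : fermatCount _ = 6)
      rcases fermatCount_mk_trichotomy v hv with
        ⟨-, i, hi⟩ | ⟨h', -⟩ | h'
      · exact ⟨i, (mk_eq_coordPt hv hi).symm⟩
      · omega
      · omega
  · rintro ⟨i, rfl⟩
    exact fermatCount_coordPt i

/-- The point `[ζ ^ j : ζ ^ k : 1]`. -/
def rootPt (p : Fin 6 × Fin 6) : P2 :=
  Projectivization.mk ℂ ![ζ ^ (p.1 : ℕ), ζ ^ (p.2 : ℕ), 1] fun h => by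
    simpa using congrFun h 2

theorem rootPt_injective : Function.Injective rootPt := by
  intro p q h
  obtain ⟨a, ha⟩ := (Projectivization.mk_eq_mk_iff' ..).mp h
  obtain rfl : a = 1 := by simpa using congrFun ha 2
  rw [one_smul] at ha
  exact Prod.ext (zeta_pow_injective (congrFun ha 0).symm)
    (zeta_pow_injective (congrFun ha 1).symm)

theorem fermatCount_rootPt (p : Fin 6 × Fin 6) : fermatCount (rootPt p) = 3 := by
  rw [rootPt, fermatCount_mk]
  simp only [Matrix.cons_val]
  rw [pencilCount_of_pow_eq (zeta_pow_ne_zero _) (by simp [zeta_pow_six]),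
    pencilCount_of_pow_eq one_ne_zero (by simp [zeta_pow_six]),
    pencilCount_of_pow_eq (zeta_pow_ne_zero _) (by simp [zeta_pow_six])]

theorem setOf_fermatCount_eq_three :
    {P : P2 | fermatCount P = 3} = Set.range rootPt := by
  ext P
  constructor
  · induction P using Projectivization.ind with
    | h v hv =>
      intro (h : fermatCount _ = 3)
      rcases fermatCount_mk_trichotomy v hv with
        ⟨h', -⟩ | ⟨-, h2, h02, h12⟩ | h'
      · omega
      · obtain ⟨j, hj⟩ := exists_eq_zeta_pow_mul h2 h02
        obtain ⟨k, hk⟩ := exists_eq_zeta_pow_mul h2 h12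
        refine ⟨(j, k), ((Projectivization.mk_eq_mk_iff' ..).mpr ⟨v 2, ?_⟩).symm⟩
        ext i
        fin_cases i
        · simp [hj, mul_comm]
        · simp [hk, mul_comm]
        · simp
      · omega
  · rintro ⟨p, rfl⟩
    exact fermatCount_rootPt p

/-- The 6th Fermat arrangement has exactly 36 triple points, its points of multiplicity 6
are exactly the 3 coordinate points, and every singular point has multiplicity 3 or 6. -/
theorem fermat6_arrangement_combinatorics :
    {P : P2 | fermatCount P = 3}.encard = 36 ∧
    {P : P2 | fermatCount P = 6} = {Q : P2 | ∃ i : Fin 3, Q = coordPt i} ∧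
    {P : P2 | fermatCount P = 6}.encard = 3 ∧
    (∀ P : P2, 2 ≤ fermatCount P → fermatCount P = 3 ∨ fermatCount P = 6) := by
  refine ⟨?_, ?_, ?_, fun P hP => ?_⟩
  · rw [setOf_fermatCount_eq_three, ← Set.image_univ, rootPt_injective.encard_image]
    simp [Set.encard_univ]
  · simp [setOf_fermatCount_eq_six, Set.range, eq_comm]
  · rw [setOf_fermatCount_eq_six, ← Set.image_univ, coordPt_injective.encard_image]
    simp [Set.encard_univ]
  · induction P using Projectivization.ind with
    | h v hv =>
      rcases fermatCount_mk_trichotomy v hv with ⟨h, -⟩ | ⟨h, -⟩ | h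
      · exact Or.inr h
      · exact Or.inl h
      · omega
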